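/- Let k be a finite field with q elements and let C be a skeletally small, idempotent-complete, k-linear triangulated category with shift functor T in which all Hom-spaces are finite, and suppose C is 2-periodic, i.e. T² ≅ Id. Then for all indecomposable objects X, Y, Z of C, q − 1 divides the integer d(X)·F_{XY}^{TZ} − d(Z)·F_{YZ}^{TX}. -/

import Mathlib

open CategoryTheory CategoryTheory.Limits CategoryTheory.Pretriangulated

universe w v u

namespace HallTri

/-- The Jacobson radical of a `k`-algebra `A`, as a `k`-submodule of `A`. -/
def radSubmodule (k : Type) [Field k] (A : Type w) [Ring A] [Algebra k A] :
    Submodule k A where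
  carrier := {x | x ∈ TwoSidedIdeal.jacobson (⊥ : TwoSidedIdeal A)}
  add_mem' := by
    intro a b ha hb
    show a + b ∈ TwoSidedIdeal.jacobson (⊥ : TwoSidedIdeal A)
    exact add_mem ha hb
  zero_mem' := by
    show (0 : A) ∈ TwoSidedIdeal.jacobson (⊥ : TwoSidedIdeal A)
    exact zero_mem _
  smul_mem' := by
    intro a x hx
    show a • x ∈ TwoSidedIdeal.jacobson (⊥ : TwoSidedIdeal A)
    rw [Algebra.smul_def]
    exact TwoSidedIdeal.mul_mem_left _ _ _ hx

/-- `dk k A` is the `k`-dimension of `A / rad A`, for a `k`-algebra `A`. -/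
noncomputable def dk (k : Type) [Field k] (A : Type w) [Ring A] [Algebra k A] : ℕ :=
  Module.finrank k (A ⧸ radSubmodule k A)

variable (k : Type) [Field k] [Fintype k]
variable {C : Type u} [Category.{v} C] [HasZeroObject C] [HasShift C ℤ] [Preadditive C]
  [∀ n : ℤ, (shiftFunctor C n).Additive] [Pretriangulated C] [IsTriangulated C]
  [Linear k C] [IsIdempotentComplete C] [HasBinaryBiproducts C]

/-- `WT X Y L` : the set of distinguished triangles `Y → L → X → TY`. -/
def WT (X Y L : C) : Type v :=
  {t : (Y ⟶ L) × (L ⟶ X) × (X ⟶ Y⟦(1 : ℤ)⟧) //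
    Triangle.mk t.1 t.2.1 t.2.2 ∈ distTriang C}

/-- Orbit relation for the action of `Aut X × Aut Y` on `WT X Y L`:
`(ξ, η) • (f, g, h) = (f∘η⁻¹, ξ∘g, (Tη)∘h∘ξ⁻¹)`. -/
def WTRel (X Y L : C) (p q : WT X Y L) : Prop :=
  ∃ (ξ : Aut X) (η : Aut Y),
    q.1.1 = η.inv ≫ p.1.1 ∧
    q.1.2.1 = p.1.2.1 ≫ ξ.hom ∧
    q.1.2.2 = ξ.inv ≫ p.1.2.2 ≫ (shiftFunctor C (1 : ℤ)).map η.hom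

/-- The triangulated Hall number `F_{XY}^L`, the number of orbits of `Aut X × Aut Y`
on `WT X Y L`. -/
noncomputable def FT (X Y L : C) : ℕ :=
  Nat.card (Quot (WTRel X Y L))


/-- Finite-ring notion of being local: nontrivial with only trivial idempotents. -/
def TI (R : Type*) [Ring R] : Prop := (0 : R) ≠ 1 ∧ ∀ e : R, e * e = e → e = 0 ∨ e = 1

lemma exists_idem_pow {R : Type*} [Ring R] [Finite R] (x : R) :
    ∃ n : ℕ, 0 < n ∧ x ^ n * x ^ n = x ^ n := by
  obtain ⟨a, b, hab, h⟩ := Finite.exists_ne_map_eq_of_infinite (fun n : ℕ => x ^ (n + 1))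
  wlog hlt : a < b generalizing a b
  · exact this b a hab.symm h.symm (by omega)
  obtain ⟨p, rfl⟩ : ∃ p, b = a + (p + 1) := ⟨b - a - 1, by omega⟩
  have key : ∀ j n : ℕ, a + 1 ≤ n → x ^ (n + j * (p + 1)) = x ^ n := by
    intro j
    induction j with
    | zero => intro n _; simp
    | succ j ih =>
      intro n hn
      have h1 : n + (j + 1) * (p + 1) = (n + (p + 1)) + j * (p + 1) := by ring
      rw [h1, ih _ (by omega)]
      obtain ⟨t, rfl⟩ := Nat.exists_eq_add_of_le hn
      have h2 : a + 1 + t + (p + 1) = (a + (p + 1) + 1) + t := by ring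
      rw [h2, pow_add, ← h, ← pow_add]
  refine ⟨(a + 1) * (p + 1), by positivity, ?_⟩
  rw [← pow_add]
  exact key _ _ (by nlinarith)

lemma TI.unit_or_nilp {R : Type*} [Ring R] [Finite R] (h : TI R) (x : R) :
    IsUnit x ∨ IsNilpotent x := by
  obtain ⟨n, hn, he⟩ := exists_idem_pow x
  rcases h.2 _ he with h0 | h1
  · exact Or.inr ⟨n, h0⟩
  · exact Or.inl (IsUnit.of_pow_eq_one h1 hn.ne')

lemma TI.not_unit_of_nilp {R : Type*} [Ring R] (h : TI R) {x : R}
    (hx : IsNilpotent x) : ¬ IsUnit x := by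
  intro hu
  obtain ⟨n, hn⟩ := hx
  have := hu.pow n
  rw [hn, isUnit_zero_iff] at this
  exact h.1 this

lemma isUnit_of_mul_right {R : Type*} [Ring R] [Finite R] {r x : R} (h : IsUnit (r * x)) :
    IsUnit x := by
  obtain ⟨u, hu⟩ := h
  have h1 : (↑u⁻¹ * r) * x = 1 := by rw [mul_assoc, ← hu]; simp
  exact IsUnit.of_mul_eq_one_right _ h1

/-- The left ideal of nonunits. -/
def nu (R : Type*) [Ring R] [Finite R] (h : TI R) : Ideal R where
  carrier := {x | ¬ IsUnit x}
  zero_mem' := by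
    show ¬ IsUnit (0 : R)
    rw [isUnit_zero_iff]; exact h.1
  add_mem' := by
    rintro a b ha hb ⟨u, hu⟩
    have h1 : ¬ IsUnit (↑u⁻¹ * a) := fun h' => ha (isUnit_of_mul_right h')
    have h2 := ((h.unit_or_nilp _).resolve_left h1).isUnit_one_sub
    have h3 : 1 - ↑u⁻¹ * a = ↑u⁻¹ * b := by
      have : (↑u⁻¹ : R) * (a + b) = 1 := by rw [← hu]; simp
      rw [← this]; noncomm_ring
    rw [h3] at h2
    exact hb (isUnit_of_mul_right h2)
  smul_mem' := by
    intro r x hx h'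
    exact hx (isUnit_of_mul_right h')

lemma mem_nu {R : Type*} [Ring R] [Finite R] (h : TI R) (x : R) :
    x ∈ nu R h ↔ ¬ IsUnit x := Iff.rfl

lemma card_units {R : Type*} [Ring R] [Finite R] (h : TI R) :
    Nat.card R = Nat.card Rˣ + Nat.card (nu R h) := by
  classical
  have e1 : Rˣ ≃ {x : R // IsUnit x} :=
    Equiv.ofBijective (fun u => ⟨u, u.isUnit⟩)
      ⟨fun a b hab => Units.ext (congrArg Subtype.val hab), fun ⟨x, u, hu⟩ => ⟨u, Subtype.ext hu⟩⟩
  rw [Nat.card_congr (Equiv.sumCompl (fun x : R => IsUnit x)).symm, Nat.card_sum,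
    Nat.card_congr e1]
  rfl

lemma card_mul {R M : Type*} [Ring R] [AddCommGroup M] [Module R M] (S : Submodule R M) :
    Nat.card M = Nat.card S * Nat.card (M ⧸ S) :=
  Submodule.card_eq_card_quotient_mul_card S

instance finQ {R M : Type*} [Ring R] [AddCommGroup M] [Module R M] [Finite M]
    (S : Submodule R M) : Finite (M ⧸ S) :=
  Finite.of_surjective S.mkQ S.mkQ_surjective

lemma nu_unique {R : Type*} [Ring R] [Finite R] (h : TI R) (I : Ideal R) (hI : I.IsMaximal) :
    I = nu R h := by
  refine hI.eq_of_le ?_ ?_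
  · intro ht
    have : (1 : R) ∈ nu R h := by rw [ht]; trivial
    exact this isUnit_one
  · intro x hx hu
    exact hI.ne_top (Ideal.eq_top_of_isUnit_mem _ hx hu)

lemma card_pow {E : Type*} [Ring E] [Finite E] (h : TI E) (n : ℕ) :
    ∀ (M : Type v) [AddCommGroup M] [Module E M] [Finite M], Nat.card M ≤ n →
      ∃ a : ℕ, Nat.card M = (Nat.card (E ⧸ nu E h)) ^ a := by
  induction n with
  | zero =>
    intro M _ _ _ hM
    have := Nat.card_pos (α := M)
    omega
  | succ n ih =>
    intro M _ _ _ hM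
    rcases subsingleton_or_nontrivial M with hs | hs
    · exact ⟨0, by simp⟩
    · obtain ⟨S, hS⟩ := IsAtomic.exists_atom (Submodule E M)
      have hsimp : IsSimpleModule E S := isSimpleModule_iff_isAtom.2 hS
      obtain ⟨I, hI, ⟨e⟩⟩ := isSimpleModule_iff_quot_maximal.1 hsimp
      have hc := card_mul S
      have : Nontrivial S := IsSimpleModule.nontrivial E S
      have h1 : 1 < Nat.card S := Finite.one_lt_card
      have h2 : 0 < Nat.card (M ⧸ S) := Nat.card_pos
      obtain ⟨a, ha⟩ := ih (M ⧸ S) (by nlinarith)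
      refine ⟨a + 1, ?_⟩
      rw [hc, ha, pow_succ, mul_comm, Nat.card_congr e.toEquiv, nu_unique h I hI]

lemma card_pow' {E : Type*} [Ring E] [Finite E] (h : TI E) 
    (M : Type v) [AddCommGroup M] [Module E M] [Finite M] :
      ∃ a : ℕ, Nat.card M = (Nat.card (E ⧸ nu E h)) ^ a := card_pow h _ M le_rfl

lemma one_lt_card_quot {E : Type*} [Ring E] [Finite E] (h : TI E) :
    1 < Nat.card (E ⧸ nu E h) := by
  have : Nontrivial (E ⧸ nu E h) := by
    rw [Submodule.Quotient.nontrivial_iff]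
    intro ht
    have : (1 : E) ∈ nu E h := by rw [ht]; trivial
    exact this isUnit_one
  exact Finite.one_lt_card

lemma map_nonunit {E R : Type*} [Ring E] [Ring R] [Finite E] (hE : TI E)
    (hR : TI R) (φ : E →+* R) {x : E} (hx : ¬ IsUnit x) : ¬ IsUnit (φ x) :=
  hR.not_unit_of_nilp (((hE.unit_or_nilp x).resolve_left hx).map φ)

/-- The index count modulo `Q - 1`. -/
lemma index_mod {E : Type v} {R : Type v} [Ring E] [Ring R] [Finite E] [Finite R] (hE : TI E)
    (hR : TI R) (φ : E →+* R) (n : ℕ)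
    (hn : n * Nat.card (Units.map (φ : E →* R)).range = Nat.card Rˣ) :
    ∃ r : ℕ, Nat.card (R ⧸ nu R hR) = (Nat.card (E ⧸ nu E hE)) ^ r ∧
      ((Nat.card (E ⧸ nu E hE) : ℤ) - 1) ∣ (n : ℤ) - r := by
  let _ : Module E R := Module.compHom R φ
  let JR : Submodule E R :=
    { carrier := {x | x ∈ nu R hR}
      add_mem' := fun ha hb => (nu R hR).add_mem ha hb
      zero_mem' := (nu R hR).zero_mem
      smul_mem' := fun c x hx => (nu R hR).smul_mem (φ c) hx }
  have hJR : Nat.card JR = Nat.card (nu R hR) := rfl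
  set Q := Nat.card (E ⧸ nu E hE) with hQ
  have hQ1 : 1 < Q := one_lt_card_quot hE
  obtain ⟨r, hr⟩ := card_pow' hE (R ⧸ JR)
  obtain ⟨b, hb⟩ := card_pow' hE JR
  obtain ⟨s, hs⟩ := card_pow' hE (nu E hE)
  obtain ⟨t, ht⟩ := card_pow' hE (RingHom.ker φ)
  rw [← hQ] at hr hb hs ht
  have hRR : Nat.card (R ⧸ nu R hR) = Q ^ r := by
    have h1 := card_mul (nu R hR)
    have h2 := card_mul JR
    rw [h1, hJR, hr] at h2
    exact Nat.eq_of_mul_eq_mul_left Nat.card_pos h2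
  refine ⟨r, hRR, ?_⟩
  -- units of E
  have hEu := card_units hE
  have hRu := card_units hR
  rw [card_mul (nu E hE), ← hQ, hs] at hEu
  rw [card_mul (nu R hR), hRR, ← hJR, hb] at hRu
  have hker : Nat.card (Units.map (φ : E →* R)).ker = Q ^ t := by
    rw [← ht]
    symm
    have hunit : ∀ x : RingHom.ker φ, IsUnit (1 + (x : E)) := by
      intro x
      by_contra hx
      have := map_nonunit hE hR φ hx
      rw [map_add, map_one, (RingHom.mem_ker).1 x.2, add_zero] at this
      exact this isUnit_one
    refine Nat.card_congr (Equiv.ofBijective (fun x => ⟨(hunit x).unit, ?_⟩) ⟨?_, ?_⟩)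
    · rw [MonoidHom.mem_ker]
      ext
      simp [(RingHom.mem_ker).1 x.2]
    · intro x y hxy
      have h1 := congrArg (fun z : (Units.map (φ : E →* R)).ker => ((z : Eˣ) : E)) hxy
      simp at h1
      exact h1
    · rintro ⟨u, hu⟩
      refine ⟨⟨(u : E) - 1, ?_⟩, ?_⟩
      · rw [RingHom.mem_ker, map_sub, map_one, sub_eq_zero]
        have := congrArg Units.val ((MonoidHom.mem_ker).1 hu)
        simpa using this
      · apply Subtype.ext
        ext
        simp
  have hrange : Nat.card Eˣ = Nat.card (Units.map (φ : E →* R)).range * Q ^ t := by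
    rw [← hker, Subgroup.card_eq_card_quotient_mul_card_subgroup (Units.map (φ : E →* R)).ker,
      Nat.card_congr (QuotientGroup.quotientKerEquivRange (Units.map (φ : E →* R))).toEquiv]
  rw [hrange] at hEu
  rw [← hn] at hRu
  set P := Nat.card (Units.map (φ : E →* R)).range
  -- n * Q^s * (Q-1) = Q^t * Q^b * (Q^r-1)
  zify at hEu hRu
  have hg : ((Q : ℤ) - 1) * (∑ i ∈ Finset.range r, (Q : ℤ) ^ i) = (Q : ℤ) ^ r - 1 :=
    mul_geom_sum _ _
  have key : ((Q : ℤ) - 1) * ((n : ℤ) * Q ^ s) =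
      ((Q : ℤ) - 1) * ((Q : ℤ) ^ (t + b) * ∑ i ∈ Finset.range r, (Q : ℤ) ^ i) := by
    calc ((Q : ℤ) - 1) * ((n : ℤ) * Q ^ s) = n * (Q ^ s * Q - Q ^ s) := by ring
      _ = n * (P * Q ^ t) := by rw [hEu]; ring
      _ = Q ^ t * (n * P) := by ring
      _ = Q ^ t * (Q ^ b * Q ^ r - Q ^ b) := by rw [hRu]; ring
      _ = Q ^ (t + b) * (Q ^ r - 1) := by ring
      _ = _ := by rw [← hg]; ring
  have key2 := mul_left_cancel₀ (by zify at hQ1; omega) key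
  have hmod : (Q : ℤ) ≡ 1 [ZMOD (Q : ℤ) - 1] := (Int.modEq_iff_dvd.2 (by
    rw [← dvd_neg]; simp))
  have hpow : ∀ i : ℕ, (Q : ℤ) ^ i ≡ 1 [ZMOD (Q : ℤ) - 1] := fun i => by
    simpa using hmod.pow i
  have hsum : (∑ i ∈ Finset.range r, (Q : ℤ) ^ i) ≡ r [ZMOD (Q : ℤ) - 1] := by
    have := Int.ModEq.sum (s := Finset.range r) (f := fun i => (Q : ℤ) ^ i) (fun i _ => hpow i)
    simpa using this
  have hl : (n : ℤ) * Q ^ s ≡ n [ZMOD (Q : ℤ) - 1] := by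
    simpa using (Int.ModEq.refl (n : ℤ)).mul (hpow s)
  have hr' := (hpow (t + b)).mul hsum
  rw [one_mul, ← key2] at hr'
  exact (hr'.symm.trans hl).dvd

lemma TI.of_equiv {R S : Type*} [Ring R] [Ring S] (e : R ≃+* S) (h : TI R) : TI S := by
  refine ⟨fun h0 => h.1 (e.injective (by simpa using h0)), fun x hx => ?_⟩
  rcases h.2 (e.symm x) (by rw [← map_mul, hx]) with h1 | h1
  · left; simpa using h1
  · right; simpa using h1

lemma card_quot_equiv {R S : Type*} [Ring R] [Ring S] [Finite R] [Finite S] (e : R ≃+* S)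
    (hR : TI R) (hS : TI S) : Nat.card (R ⧸ nu R hR) = Nat.card (S ⧸ nu S hS) := by
  have h1 := card_mul (nu R hR)
  have h2 := card_mul (nu S hS)
  have h3 : Nat.card (nu R hR) = Nat.card (nu S hS) :=
    Nat.card_congr (e.toEquiv.subtypeEquiv (fun x => by
      rw [mem_nu, mem_nu]
      exact not_congr (MulEquiv.isUnit_map e).symm))
  rw [← Nat.card_congr e.toEquiv, h1, h3] at h2
  exact Nat.eq_of_mul_eq_mul_left Nat.card_pos h2

lemma mem_rad_iff (k : Type) [Field k] {R : Type w} [Ring R] [Algebra k R] [Finite R] (h : TI R)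
    (x : R) : x ∈ radSubmodule k R ↔ x ∈ nu R h := by
  show x ∈ TwoSidedIdeal.jacobson (⊥ : TwoSidedIdeal R) ↔ _
  rw [TwoSidedIdeal.mem_jacobson_iff, mem_nu]
  constructor
  · intro hx hu
    obtain ⟨u, rfl⟩ := hu
    obtain ⟨z, hz⟩ := hx (-(↑u⁻¹))
    rw [TwoSidedIdeal.mem_bot] at hz
    simp [mul_assoc] at hz
    exact h.1 hz.symm
  · intro hx y
    have h1 : ¬ IsUnit (-(y * x)) := by
      rw [IsUnit.neg_iff]; exact fun h' => hx (isUnit_of_mul_right h')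
    obtain ⟨u, hu⟩ := ((h.unit_or_nilp _).resolve_left h1).isUnit_one_sub
    refine ⟨↑u⁻¹, ?_⟩
    rw [TwoSidedIdeal.mem_bot]
    have : (↑u⁻¹ : R) * (1 - -(y * x)) = 1 := by rw [← hu]; simp
    rw [← this]; noncomm_ring

lemma card_dk (k : Type) [Field k] [Fintype k] {R : Type w} [Ring R] [Algebra k R] [Finite R]
    (h : TI R) : Nat.card (R ⧸ nu R h) = Fintype.card k ^ dk k R := by
  have h1 := card_mul (nu R h)
  have h2 := card_mul (radSubmodule k R)
  have h3 : Nat.card (radSubmodule k R) = Nat.card (nu R h) :=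
    Nat.card_congr (Equiv.subtypeEquivRight (mem_rad_iff k h))
  rw [h1, h3] at h2
  have h4 := Nat.eq_of_mul_eq_mul_left Nat.card_pos h2
  have : Finite (R ⧸ radSubmodule k R) := inferInstance
  have := Fintype.ofFinite (R ⧸ radSubmodule k R)
  rw [h4, Nat.card_eq_fintype_card, Module.card_eq_pow_finrank (K := k), dk]

/-- The residue field of `E` has cardinality a power of `q`. -/
lemma card_res (k : Type) [Field k] [Fintype k] {E R : Type*} [Ring E] [Ring R] [Algebra k R]
    [Finite E] [Finite R] (hE : TI E) (hR : TI R) (φ : E →+* R)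
    (hk : ∀ a : k, ∃ x : E, φ x - algebraMap k R a ∈ nu R hR) :
    ∃ e : ℕ, Nat.card (E ⧸ nu E hE) = Fintype.card k ^ e := by
  let J := radSubmodule k R
  have hJ : ∀ x, x ∈ J ↔ x ∈ nu R hR := mem_rad_iff k hR
  have hJr : ∀ x y : R, x ∈ J → x * y ∈ J := fun x y hx =>
    TwoSidedIdeal.mul_mem_right (TwoSidedIdeal.jacobson (⊥ : TwoSidedIdeal R)) x y hx
  let S : Submodule k (R ⧸ J) :=
    { carrier := {z | ∃ x : E, J.mkQ (φ x) = z}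
      add_mem' := by
        rintro _ _ ⟨x, rfl⟩ ⟨y, rfl⟩
        exact ⟨x + y, by simp⟩
      zero_mem' := ⟨0, by simp⟩
      smul_mem' := by
        rintro a _ ⟨y, rfl⟩
        obtain ⟨x, hx⟩ := hk a
        refine ⟨x * y, ?_⟩
        rw [← map_smul, ← sub_eq_zero, ← map_sub, Submodule.mkQ_apply,
          Submodule.Quotient.mk_eq_zero, map_mul, Algebra.smul_def, ← sub_mul]
        exact hJr _ _ ((hJ _).2 hx) }
  have hz : ∀ x : E, φ x ∈ J ↔ x ∈ nu E hE := by
    intro x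
    rw [hJ, mem_nu, mem_nu]
    exact ⟨fun h1 h2 => h1 (h2.map φ), fun h1 => map_nonunit hE hR φ h1⟩
  let ψ : E →+ S := 
    { toFun := fun x => ⟨J.mkQ (φ x), x, rfl⟩
      map_zero' := by ext; simp
      map_add' := by intro x y; ext; simp }
  have hψ : Function.Surjective ψ := by
    rintro ⟨_, x, rfl⟩; exact ⟨x, rfl⟩
  have hker : ψ.ker = (nu E hE).toAddSubgroup := by
    ext x
    rw [AddMonoidHom.mem_ker, Submodule.mem_toAddSubgroup, ← hz, ← Submodule.Quotient.mk_eq_zero]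
    exact Subtype.ext_iff
  have hcard : Nat.card (E ⧸ nu E hE) = Nat.card S := by
    have e := QuotientAddGroup.quotientKerEquivOfSurjective ψ hψ
    exact Nat.card_congr ((QuotientAddGroup.quotientAddEquivOfEq hker).symm.trans e).toEquiv
  have := Fintype.ofFinite S
  exact ⟨_, by rw [hcard, Nat.card_eq_fintype_card, Module.card_eq_pow_finrank (K := k)]⟩

/-- Fibre of `W/ker π → W/G`. -/
lemma fibre_card {G D W : Type*} [Group G] [Group D] [MulAction G W] [Finite D]
    (π : G →* D) (hπ : Function.Surjective π)
    (F : MulAction.orbitRel.Quotient π.ker W → MulAction.orbitRel.Quotient G W)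
    (hF : ∀ w : W, F (Quotient.mk _ w) = Quotient.mk _ w) (w : W) :
    Nat.card {x // F x = Quotient.mk _ w} *
      Nat.card ((MulAction.stabilizer G w).map π) = Nat.card D := by
  rw [Subgroup.card_eq_card_quotient_mul_card_subgroup ((MulAction.stabilizer G w).map π)]
  congr 1
  symm
  have hrel : ∀ g : G, F (Quotient.mk _ (g • w)) = Quotient.mk _ w := by
    intro g
    rw [hF]
    exact Quotient.sound (MulAction.orbitRel_apply.2 ⟨g, rfl⟩)
  choose s hs using hπ
  have hiff : ∀ g g' : G, (Quotient.mk (MulAction.orbitRel π.ker W) (g • w) =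
      Quotient.mk _ (g' • w)) ↔ (π g)⁻¹ * π g' ∈ (MulAction.stabilizer G w).map π := by
    intro g g'
    rw [Quotient.eq, MulAction.orbitRel_apply, MulAction.mem_orbit_iff]
    constructor
    · rintro ⟨⟨n, hn⟩, h⟩
      rw [MonoidHom.mem_ker] at hn
      change n • g' • w = g • w at h
      refine ⟨g⁻¹ * (n * g'), ?_, by simp [hn]⟩
      show (g⁻¹ * (n * g')) • w = w
      rw [mul_smul, mul_smul, h, inv_smul_smul]
    · rintro ⟨t, ht, h⟩
      have ht' : t • w = w := ht
      refine ⟨⟨g * t * g'⁻¹, ?_⟩, ?_⟩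
      · rw [MonoidHom.mem_ker]; simp [h]
      · show (g * t * g'⁻¹) • g' • w = g • w
        rw [mul_smul, inv_smul_smul, mul_smul, ht']
  refine Nat.card_congr (Equiv.ofBijective (Quotient.lift
    (fun d : D => (⟨Quotient.mk _ (s d • w), hrel _⟩ : {x // F x = Quotient.mk _ w})) ?_) ⟨?_, ?_⟩)
  · intro a b hab
    have hab := QuotientGroup.leftRel_apply.1 hab
    apply Subtype.ext
    rw [hiff, hs, hs]; exact hab
  · intro a b
    induction a using Quotient.inductionOn with | _ a => ?_
    induction b using Quotient.inductionOn with | _ b => ?_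
    intro h
    have h1 := congrArg Subtype.val h
    simp only [Quotient.lift_mk] at h1
    rw [hiff, hs, hs] at h1
    exact Quotient.sound (QuotientGroup.leftRel_apply.2 h1)
  · rintro ⟨x, hx⟩
    induction x using Quotient.inductionOn with | _ w' => ?_
    rw [hF, Quotient.eq, MulAction.orbitRel_apply] at hx
    obtain ⟨g, rfl⟩ := hx
    refine ⟨Quotient.mk _ (π g), ?_⟩
    apply Subtype.ext
    simp only [Quotient.lift_mk]
    rw [hiff, hs]
    simp

lemma orbit_sum {G D W : Type*} [Group G] [Group D] [MulAction G W] [Finite D] [Finite W]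
    [Fintype (MulAction.orbitRel.Quotient G W)]
    (π : G →* D) (hπ : Function.Surjective π) :
    ∃ n : MulAction.orbitRel.Quotient G W → ℕ,
      Nat.card (MulAction.orbitRel.Quotient π.ker W) = ∑ ω, n ω ∧
      ∀ w, n (Quotient.mk _ w) * Nat.card ((MulAction.stabilizer G w).map π) = Nat.card D := by
  let F : MulAction.orbitRel.Quotient π.ker W → MulAction.orbitRel.Quotient G W :=
    Quotient.lift (fun w => Quotient.mk _ w) (by
      intro a b hab
      obtain ⟨g, rfl⟩ := MulAction.orbitRel_apply.1 hab
      exact Quotient.sound (MulAction.orbitRel_apply.2 ⟨g.1, rfl⟩))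
  have : Finite (MulAction.orbitRel.Quotient π.ker W) := Quotient.finite _
  refine ⟨fun ω => Nat.card {x // F x = ω}, ?_, fun w => fibre_card π hπ F (fun _ => rfl) w⟩
  rw [← Nat.card_sigma, Nat.card_congr (Equiv.sigmaFiberEquiv F)]

/-- The underlying morphism of a unit of an endomorphism ring. -/
def uh {X : C} (a : (End X)ˣ) : X ⟶ X := a.val

lemma uh_mul {X : C} (a b : (End X)ˣ) : uh (a * b) = uh b ≫ uh a := rfl

lemma uh_one {X : C} : uh (1 : (End X)ˣ) = 𝟙 X := rfl

lemma uh_inv_left {X : C} (a : (End X)ˣ) : uh a⁻¹ ≫ uh a = 𝟙 X := a.mul_inv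

lemma uh_inv_right {X : C} (a : (End X)ˣ) : uh a ≫ uh a⁻¹ = 𝟙 X := a.inv_mul

/-- The unit as an isomorphism. -/
def uIso {X : C} (a : (End X)ˣ) : X ≅ X := ⟨uh a, uh a⁻¹, uh_inv_right a, uh_inv_left a⟩

/-- An automorphism as a unit. -/
def autU {X : C} (a : Aut X) : (End X)ˣ := ⟨a.hom, a.inv, a.inv_hom_id, a.hom_inv_id⟩

/-- The full symmetry group. -/
abbrev GG (X Y L : C) := (End X)ˣ × (End Y)ˣ × (End L)ˣ

/-- The action of the full symmetry group on triangles. -/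
def actW {X Y L : C} (σ : GG X Y L) (p : WT X Y L) : WT X Y L :=
  ⟨(uh σ.2.1⁻¹ ≫ p.1.1 ≫ uh σ.2.2, uh σ.2.2⁻¹ ≫ p.1.2.1 ≫ uh σ.1,
    uh σ.1⁻¹ ≫ p.1.2.2 ≫ (shiftFunctor C (1 : ℤ)).map (uh σ.2.1)), by
    refine isomorphic_distinguished _ p.2 _ ?_
    refine Triangle.isoMk _ _ (uIso σ.2.1).symm (uIso σ.2.2).symm (uIso σ.1).symm ?_ ?_ ?_
    · show (uh σ.2.1⁻¹ ≫ p.1.1 ≫ uh σ.2.2) ≫ uh σ.2.2⁻¹ = uh σ.2.1⁻¹ ≫ p.1.1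
      rw [Category.assoc, Category.assoc, uh_inv_right, Category.comp_id]
    · show (uh σ.2.2⁻¹ ≫ p.1.2.1 ≫ uh σ.1) ≫ uh σ.1⁻¹ = uh σ.2.2⁻¹ ≫ p.1.2.1
      rw [Category.assoc, Category.assoc, uh_inv_right, Category.comp_id]
    · show (uh σ.1⁻¹ ≫ p.1.2.2 ≫ (shiftFunctor C (1 : ℤ)).map (uh σ.2.1)) ≫
        (shiftFunctor C (1 : ℤ)).map (uh σ.2.1⁻¹) = uh σ.1⁻¹ ≫ p.1.2.2
      rw [Category.assoc, Category.assoc, ← Functor.map_comp, uh_inv_right, CategoryTheory.Functor.map_id,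
        Category.comp_id]⟩

instance actI (X Y L : C) : MulAction (GG X Y L) (WT X Y L) where
  smul := actW
  one_smul p := by
    apply Subtype.ext
    show (actW 1 p).1 = p.1
    simp [actW, uh_one]
  mul_smul a b p := by
    apply Subtype.ext
    show (actW (a * b) p).1 = (actW a (actW b p)).1
    simp [actW, uh_mul]

lemma smul_def' {X Y L : C} (σ : GG X Y L) (p : WT X Y L) : σ • p = actW σ p := rfl

/-- Projection to the third factor. -/
def piL (X Y L : C) : GG X Y L →* (End L)ˣ := (MonoidHom.snd _ _).comp (MonoidHom.snd _ _)

/-- Projection to the first factor. -/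
def piX (X Y L : C) : GG X Y L →* (End X)ˣ := MonoidHom.fst _ _

lemma FT_eq (X Y L : C) :
    FT X Y L = Nat.card (MulAction.orbitRel.Quotient (piL X Y L).ker (WT X Y L)) := by
  refine Nat.card_congr (Quot.congrRight ?_)
  intro p q
  show WTRel X Y L p q ↔ MulAction.orbitRel _ _ p q
  rw [(MulAction.orbitRel (piL X Y L).ker (WT X Y L)).comm', MulAction.orbitRel_apply]
  constructor
  · rintro ⟨ξ, η, h1, h2, h3⟩
    refine ⟨⟨(autU ξ, autU η, 1), rfl⟩, ?_⟩
    show actW _ p = q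
    apply Subtype.ext
    refine Prod.ext ?_ (Prod.ext ?_ ?_)
    · rw [h1]; simp [actW, uh_one]; rfl
    · rw [h2]; simp [actW, uh_one]; rfl
    · rw [h3]; rfl
  · rintro ⟨⟨⟨ξ, η, l⟩, hl⟩, h⟩
    have hl : l = 1 := hl
    subst hl
    have h : actW _ p = q := h
    subst h
    refine ⟨uIso ξ, uIso η, ?_, ?_, ?_⟩
    · simp [actW, uh_one, uIso]
    · simp [actW, uh_one, uIso]
    · simp [actW, uIso]

/-- Relation from `Aut Y × Aut L`. -/
def Rel2 (X Y L : C) (p q : WT X Y L) : Prop := ∃ (η : Aut Y) (l : Aut L),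
    q.1.1 = η.inv ≫ p.1.1 ≫ l.hom ∧
    q.1.2.1 = l.inv ≫ p.1.2.1 ∧
    q.1.2.2 = p.1.2.2 ≫ (shiftFunctor C (1 : ℤ)).map η.hom

lemma Rel2_card (X Y L : C) :
    Nat.card (Quot (Rel2 X Y L)) =
      Nat.card (MulAction.orbitRel.Quotient (piX X Y L).ker (WT X Y L)) := by
  refine Nat.card_congr (Quot.congrRight ?_)
  intro p q
  show Rel2 X Y L p q ↔ MulAction.orbitRel _ _ p q
  rw [(MulAction.orbitRel (piX X Y L).ker (WT X Y L)).comm', MulAction.orbitRel_apply]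
  constructor
  · rintro ⟨η, l, h1, h2, h3⟩
    refine ⟨⟨(1, autU η, autU l), rfl⟩, ?_⟩
    show actW _ p = q
    apply Subtype.ext
    refine Prod.ext ?_ (Prod.ext ?_ ?_)
    · rw [h1]; rfl
    · rw [h2]; simp [actW, uh_one]; rfl
    · rw [h3]; simp [actW, uh_one]; rfl
  · rintro ⟨⟨⟨ξ, η, l⟩, hl⟩, h⟩
    have hl : ξ = 1 := hl
    subst hl
    have h : actW _ p = q := h
    subst h
    refine ⟨uIso η, uIso l, ?_, ?_, ?_⟩
    · simp [actW, uIso]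
    · simp [actW, uh_one, uIso]
    · simp [actW, uh_one, uIso]

lemma rot_equiv (X Y Z : C) (i : X⟦(1 : ℤ)⟧⟦(1 : ℤ)⟧ ≅ X) :
    FT Y Z (X⟦(1 : ℤ)⟧) = Nat.card (Quot (Rel2 X Y (Z⟦(1 : ℤ)⟧))) := by
  let T := shiftFunctor C (1 : ℤ)
  have hiff : ∀ (a : Z ⟶ X⟦(1 : ℤ)⟧) (b : X⟦(1 : ℤ)⟧ ⟶ Y) (c : Y ⟶ Z⟦(1 : ℤ)⟧),
      (Triangle.mk a b c ∈ distTriang C) ↔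
        (Triangle.mk c (-(T.map a ≫ i.hom)) (-(i.inv ≫ T.map b)) ∈ distTriang C) := by
    intro a b c
    rw [rotate_distinguished_triangle, rotate_distinguished_triangle]
    refine distinguished_iff_of_iso (Triangle.isoMk _ _ (Iso.refl _) (Iso.refl _) i ?_ ?_ ?_)
    · show c ≫ 𝟙 _ = 𝟙 _ ≫ c
      simp
    · show (-(T.map a)) ≫ i.hom = 𝟙 _ ≫ (-(T.map a ≫ i.hom))
      simp
    · show (-(T.map b)) ≫ T.map (𝟙 _) = i.hom ≫ (-(i.inv ≫ T.map b))
      simp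
  let φ : WT Y Z (X⟦(1 : ℤ)⟧) → WT X Y (Z⟦(1 : ℤ)⟧) := fun p =>
    ⟨(p.1.2.2, -(T.map p.1.1 ≫ i.hom), -(i.inv ≫ T.map p.1.2.1)), (hiff _ _ _).1 p.2⟩
  have hφ : Function.Bijective φ := by
    constructor
    · intro p q hpq
      have h0 := congrArg Subtype.val hpq
      have h1 : p.1.2.2 = q.1.2.2 := congrArg Prod.fst h0
      have h2 : -(T.map p.1.1 ≫ i.hom) = -(T.map q.1.1 ≫ i.hom) := congrArg (fun z => z.2.1) h0
      have h3 : -(i.inv ≫ T.map p.1.2.1) = -(i.inv ≫ T.map q.1.2.1) :=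
        congrArg (fun z => z.2.2) h0
      rw [neg_inj, cancel_mono] at h2
      rw [neg_inj, cancel_epi] at h3
      exact Subtype.ext (Prod.ext (T.map_injective h2) (Prod.ext (T.map_injective h3) h1))
    · rintro ⟨⟨f, g, h⟩, hd⟩
      obtain ⟨a, ha⟩ := T.map_surjective (-(g ≫ i.inv))
      obtain ⟨b, hb⟩ := T.map_surjective (-(i.hom ≫ h))
      have ha' : -(T.map a ≫ i.hom) = g := by rw [ha]; simp
      have hb' : -(i.inv ≫ T.map b) = h := by rw [hb]; simp
      refine ⟨⟨(a, b, f), (hiff _ _ _).2 ?_⟩, ?_⟩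
      · rw [ha', hb']; exact hd
      · apply Subtype.ext
        exact Prod.ext rfl (Prod.ext ha' hb')
  refine Nat.card_congr (Quot.congr (Equiv.ofBijective φ hφ) ?_)
  intro p q
  show WTRel _ _ _ p q ↔ Rel2 _ _ _ (φ p) (φ q)
  constructor
  · rintro ⟨η, ζ, h1, h2, h3⟩
    refine ⟨η, T.mapIso ζ, ?_, ?_, ?_⟩
    · exact h3
    · show -(T.map q.1.1 ≫ i.hom) = T.map ζ.inv ≫ (-(T.map p.1.1 ≫ i.hom))
      rw [h1]; simp
    · show -(i.inv ≫ T.map q.1.2.1) = (-(i.inv ≫ T.map p.1.2.1)) ≫ T.map η.hom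
      rw [h2]; simp
  · rintro ⟨η, l, h1, h2, h3⟩
    obtain ⟨ζ, rfl⟩ : ∃ ζ : Z ≅ Z, T.mapIso ζ = l := ⟨T.preimageIso l, Iso.ext (T.map_preimage l.hom)⟩
    refine ⟨η, ζ, ?_, ?_, h1⟩
    · have h2 : -(T.map q.1.1 ≫ i.hom) = T.map ζ.inv ≫ (-(T.map p.1.1 ≫ i.hom)) := h2
      rw [Preadditive.comp_neg, neg_inj, ← Category.assoc, cancel_mono, ← Functor.map_comp] at h2
      exact T.map_injective h2
    · have h3 : -(i.inv ≫ T.map q.1.2.1) = (-(i.inv ≫ T.map p.1.2.1)) ≫ T.map η.hom := h3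
      rw [Preadditive.neg_comp, neg_inj, Category.assoc, cancel_epi, ← Functor.map_comp] at h3
      exact T.map_injective h3

/-- Endomorphism ring of a triangle. -/
def triE {X Y L : C} (p : WT X Y L) : Subring (End X × End Y × End L) where
  carrier := {t | (show Y ⟶ Y from t.2.1) ≫ p.1.1 = p.1.1 ≫ (show L ⟶ L from t.2.2) ∧
    (show L ⟶ L from t.2.2) ≫ p.1.2.1 = p.1.2.1 ≫ (show X ⟶ X from t.1) ∧
    (show X ⟶ X from t.1) ≫ p.1.2.2 = p.1.2.2 ≫
      (shiftFunctor C (1 : ℤ)).map (show Y ⟶ Y from t.2.1)}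
  mul_mem' := by
    rintro ⟨x, y, l⟩ ⟨x', y', l'⟩ ⟨h1, h2, h3⟩ ⟨h1', h2', h3'⟩
    dsimp only at h1 h2 h3 h1' h2' h3'
    refine ⟨?_, ?_, ?_⟩
    · show ((y' : Y ⟶ Y) ≫ y) ≫ p.1.1 = p.1.1 ≫ ((l' : L ⟶ L) ≫ l)
      rw [Category.assoc, h1, reassoc_of% h1']
    · show ((l' : L ⟶ L) ≫ l) ≫ p.1.2.1 = p.1.2.1 ≫ ((x' : X ⟶ X) ≫ x)
      rw [Category.assoc, h2, reassoc_of% h2']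
    · show ((x' : X ⟶ X) ≫ x) ≫ p.1.2.2 = p.1.2.2 ≫
        (shiftFunctor C (1 : ℤ)).map ((y' : Y ⟶ Y) ≫ y)
      rw [Category.assoc, h3, reassoc_of% h3', Functor.map_comp]
  one_mem' := by
    refine ⟨?_, ?_, ?_⟩
    · show 𝟙 Y ≫ p.1.1 = p.1.1 ≫ 𝟙 L
      simp
    · show 𝟙 L ≫ p.1.2.1 = p.1.2.1 ≫ 𝟙 X
      simp
    · show 𝟙 X ≫ p.1.2.2 = p.1.2.2 ≫ (shiftFunctor C (1 : ℤ)).map (𝟙 Y)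
      simp
  add_mem' := by
    rintro ⟨x, y, l⟩ ⟨x', y', l'⟩ ⟨h1, h2, h3⟩ ⟨h1', h2', h3'⟩
    dsimp only at h1 h2 h3 h1' h2' h3'
    refine ⟨?_, ?_, ?_⟩
    · show ((y : Y ⟶ Y) + y') ≫ p.1.1 = p.1.1 ≫ ((l : L ⟶ L) + l')
      rw [Preadditive.add_comp, Preadditive.comp_add, h1, h1']
    · show ((l : L ⟶ L) + l') ≫ p.1.2.1 = p.1.2.1 ≫ ((x : X ⟶ X) + x')
      rw [Preadditive.add_comp, Preadditive.comp_add, h2, h2']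
    · show ((x : X ⟶ X) + x') ≫ p.1.2.2 = p.1.2.2 ≫
        (shiftFunctor C (1 : ℤ)).map ((y : Y ⟶ Y) + y')
      rw [Functor.map_add, Preadditive.add_comp, Preadditive.comp_add, h3, h3']
  zero_mem' := by
    refine ⟨?_, ?_, ?_⟩
    · show (0 : Y ⟶ Y) ≫ p.1.1 = p.1.1 ≫ (0 : L ⟶ L)
      simp
    · show (0 : L ⟶ L) ≫ p.1.2.1 = p.1.2.1 ≫ (0 : X ⟶ X)
      simp
    · show (0 : X ⟶ X) ≫ p.1.2.2 = p.1.2.2 ≫ (shiftFunctor C (1 : ℤ)).map (0 : Y ⟶ Y)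
      simp
  neg_mem' := by
    rintro ⟨x, y, l⟩ ⟨h1, h2, h3⟩
    dsimp only at h1 h2 h3
    refine ⟨?_, ?_, ?_⟩
    · show (-(y : Y ⟶ Y)) ≫ p.1.1 = p.1.1 ≫ (-(l : L ⟶ L))
      rw [Preadditive.neg_comp, Preadditive.comp_neg, h1]
    · show (-(l : L ⟶ L)) ≫ p.1.2.1 = p.1.2.1 ≫ (-(x : X ⟶ X))
      rw [Preadditive.neg_comp, Preadditive.comp_neg, h2]
    · show (-(x : X ⟶ X)) ≫ p.1.2.2 = p.1.2.2 ≫ (shiftFunctor C (1 : ℤ)).map (-(y : Y ⟶ Y))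
      rw [Functor.map_neg, Preadditive.neg_comp, Preadditive.comp_neg, h3]

lemma mem_triE {X Y L : C} (p : WT X Y L) (x : X ⟶ X) (y : Y ⟶ Y) (l : L ⟶ L) :
    ((x, y, l) : End X × End Y × End L) ∈ triE p ↔ y ≫ p.1.1 = p.1.1 ≫ l ∧
      l ≫ p.1.2.1 = p.1.2.1 ≫ x ∧
      x ≫ p.1.2.2 = p.1.2.2 ≫ (shiftFunctor C (1 : ℤ)).map y := Iff.rfl

/-- Component at `X`. -/
def phX {X Y L : C} (p : WT X Y L) : triE p →+* End X :=
  (RingHom.fst _ _).comp (triE p).subtype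

/-- Component at `L`. -/
def phL {X Y L : C} (p : WT X Y L) : triE p →+* End L :=
  (RingHom.snd _ _).comp ((RingHom.snd _ _).comp (triE p).subtype)

lemma stab_iff {X Y L : C} (p : WT X Y L) (σ : GG X Y L) :
    σ ∈ MulAction.stabilizer (GG X Y L) p ↔
      ((σ.1.val, σ.2.1.val, σ.2.2.val) : End X × End Y × End L) ∈ triE p := by
  have key : ∀ {A B A' B' : C} (a : A ≅ A') (b : B ≅ B') (f : A ⟶ B) (f' : A' ⟶ B'),
      a.inv ≫ f ≫ b.hom = f' ↔ a.hom ≫ f' = f ≫ b.hom := by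
    intro A B A' B' a b f f'
    rw [Iso.inv_comp_eq]; exact eq_comm
  obtain ⟨ξ, η, l⟩ := σ
  rw [MulAction.mem_stabilizer_iff, smul_def']
  refine Iff.trans ?_ (mem_triE p (uh ξ) (uh η) (uh l)).symm
  refine Iff.trans ?_ (and_congr (key (uIso η) (uIso l) p.1.1 p.1.1)
    (and_congr (key (uIso l) (uIso ξ) p.1.2.1 p.1.2.1)
      (key (uIso ξ) ((shiftFunctor C (1 : ℤ)).mapIso (uIso η)) p.1.2.2 p.1.2.2)))
  constructor
  · intro h
    have h0 := congrArg Subtype.val h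
    exact ⟨congrArg Prod.fst h0, congrArg (fun z => z.2.1) h0, congrArg (fun z => z.2.2) h0⟩
  · rintro ⟨h1, h2, h3⟩
    exact Subtype.ext (Prod.ext h1 (Prod.ext h2 h3))

/-- A stabilizing triple as a unit of the triangle endomorphism ring. -/
def stabU {X Y L : C} (p : WT X Y L) (σ : GG X Y L)
    (h : σ ∈ MulAction.stabilizer (GG X Y L) p) : (triE p)ˣ where
  val := ⟨(σ.1.val, σ.2.1.val, σ.2.2.val), (stab_iff p σ).1 h⟩
  inv := ⟨((σ⁻¹).1.val, (σ⁻¹).2.1.val, (σ⁻¹).2.2.val), (stab_iff p σ⁻¹).1 (inv_mem h)⟩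
  val_inv := by apply Subtype.ext; simp [Prod.ext_iff]
  inv_val := by apply Subtype.ext; simp [Prod.ext_iff]

/-- A unit of the triangle endomorphism ring as a triple of units. -/
def unU {X Y L : C} (p : WT X Y L) (u : (triE p)ˣ) : GG X Y L :=
  let t := Units.map ((triE p).subtype : triE p →* End X × End Y × End L) u
  (Units.map (MonoidHom.fst _ _) t,
   Units.map ((MonoidHom.fst _ _).comp (MonoidHom.snd _ _)) t,
   Units.map ((MonoidHom.snd _ _).comp (MonoidHom.snd _ _)) t)

lemma unU_mem {X Y L : C} (p : WT X Y L) (u : (triE p)ˣ) :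
    unU p u ∈ MulAction.stabilizer (GG X Y L) p := (stab_iff p _).2 u.val.2

lemma stab_L {X Y L : C} (p : WT X Y L) :
    (MulAction.stabilizer (GG X Y L) p).map (piL X Y L) =
      (Units.map (phL p : triE p →* End L)).range := by
  ext d
  constructor
  · rintro ⟨σ, hσ, rfl⟩
    exact ⟨stabU p σ hσ, by ext; rfl⟩
  · rintro ⟨u, rfl⟩
    exact ⟨unU p u, unU_mem p u, by ext; rfl⟩

lemma stab_X {X Y L : C} (p : WT X Y L) :
    (MulAction.stabilizer (GG X Y L) p).map (piX X Y L) =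
      (Units.map (phX p : triE p →* End X)).range := by
  ext d
  constructor
  · rintro ⟨σ, hσ, rfl⟩
    exact ⟨stabU p σ hσ, by ext; rfl⟩
  · rintro ⟨u, rfl⟩
    exact ⟨unU p u, unU_mem p u, by ext; rfl⟩

lemma not_isZero_of_TI {X : C} (h : TI (End X)) : ¬ IsZero X := fun hz =>
  h.1 (hz.eq_of_src (0 : X ⟶ X) (𝟙 X))

lemma triE_TI {X Y L : C} (p : WT X Y L) (hX : TI (End X)) (hY : TI (End Y)) (hL : TI (End L)) :
    TI (triE p) := by
  refine ⟨fun h => hX.1 (congrArg (fun t => t.1.1) h), ?_⟩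
  rintro ⟨⟨x, y, l⟩, hm⟩ he
  have he' := congrArg Subtype.val he
  have ex : x * x = x := congrArg (fun t => t.1) he'
  have ey : y * y = y := congrArg (fun t => t.2.1) he'
  have el : l * l = l := congrArg (fun t => t.2.2) he'
  obtain ⟨h1, h2, h3⟩ := (mem_triE p x y l).1 hm
  have cY : ¬ (p.1.1 = 0 ∧ p.1.2.2 = 0) := fun h =>
    not_isZero_of_TI hY ((Triangle.isZero₁_iff _ p.2).2 h)
  have cL : ¬ (p.1.1 = 0 ∧ p.1.2.1 = 0) := fun h =>
    not_isZero_of_TI hL ((Triangle.isZero₂_iff _ p.2).2 h)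
  have cX : ¬ (p.1.2.1 = 0 ∧ p.1.2.2 = 0) := fun h =>
    not_isZero_of_TI hX ((Triangle.isZero₃_iff _ p.2).2 h)
  have z1 : ∀ A : C, (0 : End A) = (0 : A ⟶ A) := fun _ => rfl
  have o1 : ∀ A : C, (1 : End A) = 𝟙 A := fun _ => rfl
  rcases hX.2 x ex with rfl | rfl <;> rcases hY.2 y ey with rfl | rfl <;>
    rcases hL.2 l el with rfl | rfl <;>
    simp only [z1, o1, Category.comp_id, Category.id_comp, comp_zero, zero_comp, Functor.map_zero,
      CategoryTheory.Functor.map_id] at h1 h2 h3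
  · left; rfl
  · exact (cL ⟨h1.symm, h2⟩).elim
  · exact (cY ⟨h1, h3.symm⟩).elim
  · exact (cX ⟨h2, h3.symm⟩).elim
  · exact (cX ⟨h2.symm, h3⟩).elim
  · exact (cY ⟨h1.symm, h3⟩).elim
  · exact (cL ⟨h1, h2.symm⟩).elim
  · right; rfl

/-- The shift as a ring isomorphism of endomorphism rings. -/
noncomputable def shiftEnd (X : C) : End X ≃+* End (X⟦(1 : ℤ)⟧) :=
  RingEquiv.ofBijective
    ({ toFun := fun a => (shiftFunctor C (1 : ℤ)).map a
       map_one' := (shiftFunctor C (1 : ℤ)).map_id X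
       map_mul' := fun a b => (shiftFunctor C (1 : ℤ)).map_comp b a
       map_zero' := (shiftFunctor C (1 : ℤ)).map_zero X X
       map_add' := fun {a b} => (shiftFunctor C (1 : ℤ)).map_add (f := a) (g := b) } :
      End X →+* End (X⟦(1 : ℤ)⟧))
    ⟨(shiftFunctor C (1 : ℤ)).map_injective, (shiftFunctor C (1 : ℤ)).map_surjective⟩

lemma indec_idem {X : C} (h : Indecomposable X) (e : X ⟶ X) (he' : e ≫ e = e) :
    e = 0 ∨ e = 𝟙 X := by
  have he2 : (𝟙 X - e) ≫ (𝟙 X - e) = 𝟙 X - e := by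
    simp [Preadditive.sub_comp, Preadditive.comp_sub, he']
  obtain ⟨A, i, r, hi, hr⟩ := IsIdempotentComplete.idempotents_split X e he'
  obtain ⟨B, j, s, hj, hs⟩ := IsIdempotentComplete.idempotents_split X _ he2
  have hir : i ≫ e = i := by rw [← hr, reassoc_of% hi]
  have hre : e ≫ r = r := by rw [← hr, Category.assoc, hi, Category.comp_id]
  have hjs : j ≫ (𝟙 X - e) = j := by rw [← hs, reassoc_of% hj]
  have hse : (𝟙 X - e) ≫ s = s := by
    rw [← hs, Category.assoc, hj, Category.comp_id]
  have hje : j ≫ e = 0 := by simpa [Preadditive.comp_sub] using hjs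
  have hes : e ≫ s = 0 := by simpa [Preadditive.sub_comp] using hse
  have his : i ≫ s = 0 := by rw [← hir, Category.assoc, hes, comp_zero]
  have hjr : j ≫ r = 0 := by rw [← hre, ← Category.assoc, hje, zero_comp]
  have iso : X ≅ A ⊞ B :=
    { hom := biprod.lift r s
      inv := biprod.desc i j
      hom_inv_id := by rw [biprod.lift_desc, hr, hs]; simp
      inv_hom_id := by
        apply biprod.hom_ext <;> apply biprod.hom_ext' <;> simp [hi, hj, his, hjr] }
  rcases h.2 A B iso with hz | hz
  · left
    rw [← hr, hz.eq_of_tgt r 0, zero_comp]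
  · right
    rw [hz.eq_of_tgt s 0, zero_comp] at hs
    exact (sub_eq_zero.1 hs.symm).symm

lemma indec_TI {X : C} (h : Indecomposable X) : TI (End X) :=
  ⟨fun h0 => h.1 ((IsZero.iff_id_eq_zero X).2 h0.symm), fun e he => indec_idem h e he⟩

lemma scalar_lift {X Y L : C} [Finite (End X)] (p : WT X Y L) (hX : TI (End X)) (hY : TI (End Y))
    (hL : TI (End L)) (a : k) :
    ∃ t : triE p, phX p t - algebraMap k (End X) a ∈ nu (End X) hX := by
  have h1 : p.1.1 ≫ (a • 𝟙 L) = (a • 𝟙 Y) ≫ p.1.1 := by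
    rw [Linear.comp_smul, Linear.smul_comp, Category.comp_id, Category.id_comp]
  obtain ⟨c, hc1, hc2⟩ : ∃ c : X ⟶ X, p.1.2.1 ≫ c = (a • 𝟙 L) ≫ p.1.2.1 ∧
      p.1.2.2 ≫ (shiftFunctor C (1 : ℤ)).map (a • 𝟙 Y) = c ≫ p.1.2.2 :=
    complete_distinguished_triangle_morphism _ _ p.2 p.2 (a • 𝟙 Y) (a • 𝟙 L) h1
  refine ⟨⟨(c, a • 𝟙 Y, a • 𝟙 L), (mem_triE p _ _ _).2 ⟨h1.symm, hc1.symm, hc2.symm⟩⟩, ?_⟩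
  rw [mem_nu]
  intro hu
  have halg : algebraMap k (End X) a = (a • 𝟙 X : X ⟶ X) := by
    rw [Algebra.algebraMap_eq_smul_one]; rfl
  obtain ⟨u, hu⟩ := hu
  have hu' : uh u = c - a • 𝟙 X := by
    refine Eq.trans hu ?_
    rw [halg]; rfl
  have h0 : p.1.2.1 ≫ uh u = 0 := by
    rw [hu', Preadditive.comp_sub, hc1, Linear.comp_smul, Linear.smul_comp, Category.comp_id,
      Category.id_comp, sub_self]
  obtain ⟨v, hv⟩ : ∃ v : Y⟦(1 : ℤ)⟧ ⟶ X, uh u = p.1.2.2 ≫ v :=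
    Triangle.yoneda_exact₃ _ p.2 (uh u) h0
  let v' := v ≫ uh u⁻¹
  have hv' : p.1.2.2 ≫ v' = 𝟙 X := by
    show p.1.2.2 ≫ v ≫ uh u⁻¹ = 𝟙 X
    rw [← Category.assoc, ← hv, uh_inv_right]
  have hg : p.1.2.1 = 0 := by
    have : p.1.2.1 ≫ p.1.2.2 = 0 := comp_distTriang_mor_zero₂₃ _ p.2
    rw [← Category.comp_id p.1.2.1, ← hv', reassoc_of% this, zero_comp]
  have hTY : TI (End (Y⟦(1 : ℤ)⟧)) := hY.of_equiv (shiftEnd Y)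
  have hid : (v' ≫ p.1.2.2) ≫ (v' ≫ p.1.2.2) = v' ≫ p.1.2.2 := by
    rw [Category.assoc, reassoc_of% hv']
  rcases hTY.2 (v' ≫ p.1.2.2) hid with h | h
  · apply hX.1
    show (0 : X ⟶ X) = 𝟙 X
    have h : v' ≫ p.1.2.2 = 0 := h
    rw [← Category.comp_id (𝟙 X), ← hv', Category.assoc, reassoc_of% h]
    simp
  · have h : v' ≫ p.1.2.2 = 𝟙 _ := h
    have hiso : IsIso p.1.2.2 := ⟨v', hv', h⟩
    exact not_isZero_of_TI hL ((Triangle.isZero₂_iff_isIso₃ _ p.2).2 hiso)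

lemma core (hHom : ∀ A B : C, Finite (A ⟶ B)) (X Y L : C)
    (hX : TI (End X)) (hY : TI (End Y)) (hL : TI (End L)) (fX : Finite (End X))
    (fL : Finite (End L)) (dX dL : ℕ)
    (hdX : Nat.card (End X ⧸ nu (End X) hX) = Fintype.card k ^ dX)
    (hdL : Nat.card (End L ⧸ nu (End L) hL) = Fintype.card k ^ dL) :
    ((Fintype.card k : ℤ) - 1) ∣
      (dX : ℤ) * (FT X Y L : ℤ) - (dL : ℤ) * (Nat.card (Quot (Rel2 X Y L)) : ℤ) := by
  classical
  have fY : Finite (End Y) := hHom Y Y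
  have : Finite (WT X Y L) := by
    have := hHom Y L
    have := hHom L X
    have := hHom X (Y⟦(1 : ℤ)⟧)
    unfold WT
    infer_instance
  have : Finite (MulAction.orbitRel.Quotient (GG X Y L) (WT X Y L)) := Quotient.finite _
  have := Fintype.ofFinite (MulAction.orbitRel.Quotient (GG X Y L) (WT X Y L))
  obtain ⟨nL, hnL, hnL'⟩ := orbit_sum (W := WT X Y L) (piL X Y L) (fun d => ⟨(1, 1, d), rfl⟩)
  obtain ⟨nX, hnX, hnX'⟩ := orbit_sum (W := WT X Y L) (piX X Y L) (fun d => ⟨(d, 1, 1), rfl⟩)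
  rw [FT_eq, Rel2_card, hnL, hnX]
  push_cast
  rw [Finset.mul_sum, Finset.mul_sum, ← Finset.sum_sub_distrib]
  refine Finset.dvd_sum fun ω _ => ?_
  induction ω using Quotient.inductionOn with | _ p => ?_
  have h1 := hnL' p
  have h2 := hnX' p
  rw [stab_L] at h1
  rw [stab_X] at h2
  have hE := triE_TI p hX hY hL
  obtain ⟨rL, hrL, hdvL⟩ := index_mod hE hL (phL p) _ h1
  obtain ⟨rX, hrX, hdvX⟩ := index_mod hE hX (phX p) _ h2
  obtain ⟨e, he⟩ := card_res k hE hX (phX p) (scalar_lift k p hX hY hL)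
  rw [he] at hrL hrX hdvL hdvX
  have hq : 1 < Fintype.card k := Fintype.one_lt_card
  rw [hdL, ← pow_mul] at hrL
  rw [hdX, ← pow_mul] at hrX
  have eL : dL = e * rL := Nat.pow_right_injective hq hrL
  have eX : dX = e * rX := Nat.pow_right_injective hq hrX
  have hdiv : ((Fintype.card k : ℤ) - 1) ∣ ((Fintype.card k ^ e : ℕ) : ℤ) - 1 := by
    push_cast
    simpa using sub_dvd_pow_sub_pow (Fintype.card k : ℤ) 1 e
  have a1 := (hdiv.trans hdvL).mul_left (dX : ℤ)
  have a2 := (hdiv.trans hdvX).mul_left (dL : ℤ)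
  have a3 := dvd_sub a1 a2
  convert a3 using 1
  rw [eL, eX]
  push_cast
  ring

/-- If `C` is moreover 2-periodic, then for all indecomposable `X, Y, Z`,
`q - 1` divides `d(X)·F_{XY}^{TZ} - d(Z)·F_{YZ}^{TX}`. -/
theorem d_mul_F_symm (hHom : ∀ A B : C, Finite (A ⟶ B))
    (per : Nonempty (shiftFunctor C (2 : ℤ) ≅ 𝟭 C))
    (X Y Z : C) (hX : Indecomposable X) (hY : Indecomposable Y)
    (hZ : Indecomposable Z) :
    ((Fintype.card k : ℤ) - 1) ∣
      (dk k (End X) : ℤ) * (FT X Y (Z⟦(1 : ℤ)⟧) : ℤ) -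
        (dk k (End Z) : ℤ) * (FT Y Z (X⟦(1 : ℤ)⟧) : ℤ) := by
  obtain ⟨per⟩ := per
  have fX : Finite (End X) := hHom X X
  have fZ : Finite (End Z) := hHom Z Z
  have fL : Finite (End (Z⟦(1 : ℤ)⟧)) := hHom _ _
  have tX := indec_TI hX
  have tZ := indec_TI hZ
  have tL := tZ.of_equiv (shiftEnd Z)
  rw [rot_equiv X Y Z ((shiftFunctorAdd' C (1 : ℤ) 1 2 (by norm_num)).symm.app X ≪≫ per.app X)]
  refine core k hHom X Y _ tX (indec_TI hY) tL fX fL _ _ (card_dk k tX) ?_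
  rw [← card_quot_equiv (shiftEnd Z) tZ tL]
  exact card_dk k tZ

end HallTri
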